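/- arXiv:1601.06181 — 7 statements merged into one kernel-verified Lean document; each statement's English description precedes it below -/
import Mathlib

section
/- For every real M ≥ 2 there exists a unique x ∈ (0,1) with −ln x = 1 − x/M. Moreover, this x is the unique maximizer over h ∈ (0,1) of the function f(h) = −h·ln h / (1 − h/M), and the maximum value satisfies f(x) = x. -/
theorem neg_mul_log_div_lt_of_neg_log_eq {M x y : ℝ} (hx : 0 < x) (hy : 0 < y)
    (hyM : 0 < 1 - y / M) (h : -Real.log x = 1 - x / M) (hne : y ≠ x) :
    -y * Real.log y / (1 - y / M) < x := by
  rw [div_lt_iff₀ hyM]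
  have hlog : Real.log (x / y) < x / y - 1 :=
    Real.log_lt_sub_one_of_pos (div_pos hx hy) fun h1 => hne ((div_eq_one_iff_eq hy.ne').1 h1).symm
  rw [Real.log_div hx.ne' hy.ne', lt_sub_iff_add_lt, lt_div_iff₀ hy] at hlog
  have hxl : Real.log x = x / M - 1 := by linarith
  rw [hxl] at hlog
  linear_combination hlog

theorem exists_neg_log_eq_one_sub_div {M : ℝ} (hM : 1 < M) :
    ∃ x ∈ Set.Ioo (0 : ℝ) 1, -Real.log x = 1 - x / M := by
  have hM0 : 0 < M := by linarith
  have he : Real.exp (-1) < 1 := by simp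
  have hcont : ContinuousOn (fun t : ℝ => Real.log t + 1 - t / M) (Set.Icc (Real.exp (-1)) 1) :=
    ((Real.continuousOn_log.mono fun t ht => ((Real.exp_pos _).trans_le ht.1).ne').add
      continuousOn_const).sub (continuousOn_id.div_const M)
  have hmem : (0 : ℝ) ∈ Set.Ioo (Real.log (Real.exp (-1)) + 1 - Real.exp (-1) / M)
      (Real.log 1 + 1 - 1 / M) := by
    have h1 : 0 < Real.exp (-1) / M := by positivity
    have h2 : 1 / M < 1 := (div_lt_one hM0).2 hM
    rw [Real.log_exp, Real.log_one]
    constructor <;> linarith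
  obtain ⟨x, hx, h⟩ := intermediate_value_Ioo he.le hcont hmem
  exact ⟨x, ⟨(Real.exp_pos _).trans hx.1, hx.2⟩, by simp only at h; linarith⟩

/-- For every real `M ≥ 2` there is a unique `x ∈ (0,1)` with `−ln x = 1 − x/M`;
moreover this `x` is the unique maximizer over `(0,1)` of `f(h) = −h·ln h/(1 − h/M)`, and
`f(x) = x`. -/
theorem stmt8 (M : ℝ) (hM : 2 ≤ M) :
    ∃ x : ℝ, (x ∈ Set.Ioo (0 : ℝ) 1 ∧ -Real.log x = 1 - x / M) ∧
      (∀ y ∈ Set.Ioo (0 : ℝ) 1, -Real.log y = 1 - y / M → y = x) ∧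
      (∀ y ∈ Set.Ioo (0 : ℝ) 1, y ≠ x →
        -y * Real.log y / (1 - y / M) < -x * Real.log x / (1 - x / M)) ∧
      -x * Real.log x / (1 - x / M) = x := by
  have hpos : ∀ y ∈ Set.Ioo (0 : ℝ) 1, 0 < 1 - y / M := fun y hy =>
    sub_pos.2 ((div_lt_one (by linarith)).2 (by linarith [hy.2]))
  have hval : ∀ y ∈ Set.Ioo (0 : ℝ) 1, -Real.log y = 1 - y / M →
      -y * Real.log y / (1 - y / M) = y := fun y hy h => by
    rw [neg_mul_comm, h, mul_div_cancel_right₀ _ (hpos y hy).ne']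
  obtain ⟨x, hx, h⟩ := exists_neg_log_eq_one_sub_div (M := M) (by linarith)
  refine ⟨x, ⟨hx, h⟩, fun y hy hy' => ?_, fun y hy hne => ?_, hval x hx h⟩
  · by_contra hne
    have h1 := neg_mul_log_div_lt_of_neg_log_eq hx.1 hy.1 (hpos y hy) h hne
    have h2 := neg_mul_log_div_lt_of_neg_log_eq hy.1 hx.1 (hpos x hx) hy' (Ne.symm hne)
    rw [hval y hy hy'] at h1
    rw [hval x hx h] at h2
    exact lt_asymm h1 h2
  · rw [hval x hx h]
    exact neg_mul_log_div_lt_of_neg_log_eq hx.1 hy.1 (hpos y hy) h hne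
end

section
/- Let N ≥ 2 be a real number and suppose h ∈ (0,1) satisfies −ln h = 1 − h/N. Then h ≥ N/(N·e − 1), where e is Euler's number. -/
/-- If `N ≥ 2` and `h ∈ (0,1)` satisfies `−ln h = 1 − h/N`,
then `h ≥ N/(N·e − 1)`. -/
theorem stmt9 (N h : ℝ) (hN : 2 ≤ N) (h01 : h ∈ Set.Ioo (0 : ℝ) 1)
    (heq : -Real.log h = 1 - h / N) :
    N / (N * Real.exp 1 - 1) ≤ h := by
  have hN0 : 0 < N := by linarith
  have he : 2 ≤ Real.exp 1 := by linarith [Real.add_one_le_exp (1 : ℝ)]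
  have hpos : 0 < N * Real.exp 1 - 1 := by nlinarith
  have hexp : h * Real.exp 1 = Real.exp (h / N) := by
    conv_lhs => rw [← Real.exp_log h01.1, ← Real.exp_add]
    congr 1
    linarith
  have hle : h / N + 1 ≤ h * Real.exp 1 := hexp ▸ Real.add_one_le_exp (h / N)
  have hmul : N * (h / N + 1) ≤ N * (h * Real.exp 1) :=
    mul_le_mul_of_nonneg_left hle hN0.le
  have hcancel : N * (h / N) = h := mul_div_cancel₀ h hN0.ne'
  rw [div_le_iff₀ hpos]
  linarith
end

section
/- With zero initial values (c_i = 0 for all i ≥ 1), the recursively defined functions satisfy, for every integer i ≥ 0 and every t ≥ 0, Q_i(t) = N^i · Σ_{k=i}^∞ (t/N)^k / k!. -/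
open MeasureTheory intervalIntegral

/-- The recursively defined functions `Q_0(t) = e^{t/N}` and
`Q_i(t) = ∫_0^t Q_{i−1}(z) dz + c_i·Q_{i−1}(0)` for `i ≥ 1`. -/
noncomputable def Qfun (N : ℝ) (c : ℕ → ℝ) : ℕ → ℝ → ℝ
  | 0 => fun t => Real.exp (t / N)
  | i + 1 => fun t => (∫ z in (0 : ℝ)..t, Qfun N c i z) + c (i + 1) * Qfun N c i 0

open Finset in
theorem hasDerivAt_sum_range_succ_pow_div_factorial (n : ℕ) (x : ℝ) :
    HasDerivAt (fun y : ℝ => ∑ k ∈ range (n + 1), y ^ k / (Nat.factorial k : ℝ))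
      (∑ k ∈ range n, x ^ k / (Nat.factorial k : ℝ)) x := by
  induction n with
  | zero => simpa using hasDerivAt_const x (1 : ℝ)
  | succ n ih =>
    have h := ih.add ((hasDerivAt_pow (n + 1) x).div_const (Nat.factorial (n + 1) : ℝ))
    simp only [sum_range_succ _ (n + 1)]
    refine h.congr_deriv ?_
    rw [sum_range_succ, Nat.factorial_succ]
    have hn : ((n : ℝ) + 1) ≠ 0 := by positivity
    have hf : (Nat.factorial n : ℝ) ≠ 0 := by positivity
    push_cast
    field_simp

open Finset in
theorem Qfun_zero_eq_exp_sub_sum {N : ℝ} (hN : N ≠ 0) (i : ℕ) (t : ℝ) :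
    Qfun N (fun _ => 0) i t
      = N ^ i * (Real.exp (t / N) - ∑ k ∈ range i, (t / N) ^ k / (Nat.factorial k : ℝ)) := by
  induction i generalizing t with
  | zero => simp [Qfun]
  | succ i ih =>
    have hderiv (z : ℝ) : HasDerivAt
        (fun z => N ^ (i + 1) * (Real.exp (z / N)
          - ∑ k ∈ range (i + 1), (z / N) ^ k / (Nat.factorial k : ℝ)))
        (N ^ i * (Real.exp (z / N) - ∑ k ∈ range i, (z / N) ^ k / (Nat.factorial k : ℝ))) z := by
      have h := (((Real.hasDerivAt_exp (z / N)).sub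
        (hasDerivAt_sum_range_succ_pow_div_factorial i (z / N))).comp z
          ((hasDerivAt_id z).div_const N)).const_mul (N ^ (i + 1))
      refine h.congr_deriv ?_
      field_simp
      ring
    have hcont : Continuous fun z : ℝ =>
        N ^ i * (Real.exp (z / N) - ∑ k ∈ range i, (z / N) ^ k / (Nat.factorial k : ℝ)) := by
      fun_prop
    simp only [Qfun, ih]
    rw [integral_eq_sub_of_hasDerivAt (fun z _ => hderiv z) (hcont.intervalIntegrable 0 t)]
    simp [sum_range_succ' _ i]

open Finset in
theorem hasSum_exp_tail (i : ℕ) (x : ℝ) :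
    HasSum (fun k : ℕ => if i ≤ k then x ^ k / (Nat.factorial k : ℝ) else 0)
      (Real.exp x - ∑ k ∈ range i, x ^ k / (Nat.factorial k : ℝ)) := by
  have hexp : HasSum (fun k : ℕ => x ^ k / (Nat.factorial k : ℝ)) (Real.exp x) := by
    rw [Real.exp_eq_exp_ℝ]
    exact NormedSpace.expSeries_div_hasSum_exp x
  have hhead : HasSum (fun k : ℕ => if k < i then x ^ k / (Nat.factorial k : ℝ) else 0)
      (∑ k ∈ range i, x ^ k / (Nat.factorial k : ℝ)) := by
    have hs := hasSum_sum_of_ne_finset_zero (L := .unconditional ℕ) (s := range i)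
      (f := fun k : ℕ => if k < i then x ^ k / (Nat.factorial k : ℝ) else 0)
      (by intro k hk; simp_all)
    rwa [sum_congr rfl fun k hk => if_pos (mem_range.mp hk)] at hs
  have hsplit : (fun k : ℕ => if i ≤ k then x ^ k / (Nat.factorial k : ℝ) else 0) =
      fun k : ℕ => x ^ k / (Nat.factorial k : ℝ)
        - if k < i then x ^ k / (Nat.factorial k : ℝ) else 0 := by
    ext k
    by_cases hk : k < i
    · simp [hk]
    · simp [hk, not_lt.mp hk]
  rw [hsplit]
  exact hexp.sub hhead

/-- With zero initial values (`c_i = 0` for all `i ≥ 1`), for every `i ≥ 0` and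
`t ≥ 0`, `Q_i(t) = N^i · Σ_{k=i}^∞ (t/N)^k / k!`. -/
theorem stmt12 (N : ℝ) (hN : 1 < N) (i : ℕ) (t : ℝ) (ht : 0 ≤ t) :
    Qfun N (fun _ => 0) i t
      = N ^ i * ∑' k : ℕ, if i ≤ k then (t / N) ^ k / (Nat.factorial k : ℝ) else 0 := by
  rw [(hasSum_exp_tail i (t / N)).tsum_eq]
  exact Qfun_zero_eq_exp_sub_sum (by positivity) i t
end

section
/- Suppose the initial values (h_i(0))_{i≥0} form a regularly ordered sequence and that, for the resulting solution, r_2(T) ≥ 1/(2 − 1/N). Then for every i ≥ 2, the function r_i is non-increasing on [0,T], and r_i(t) ≥ R_{i−1}(t) for all t ∈ [0,T]. -/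
/-- A strictly positive sequence `x` with `x 0 = N` is regularly ordered if `(x_i)_{i≥1}` is
monotonically decreasing, `x_1 ≤ 1`, and `x_i/x_{i−1} ≥ 1/(2 − x_{i−1}/x_{i−2})` for `i ≥ 2`. -/
def RegularlyOrdered (N : ℝ) (x : ℕ → ℝ) : Prop :=
  x 0 = N ∧ (∀ i, 0 < x i) ∧ (∀ i, 1 ≤ i → x (i + 1) ≤ x i) ∧ x 1 ≤ 1 ∧
    ∀ i, 2 ≤ i → 1 / (2 - x (i - 1) / x (i - 2)) ≤ x i / x (i - 1)

open Set

/-- The linear equation `E' = c E` with continuous coefficient has a positive solution. -/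
theorem exists_pos_hasDerivWithinAt_mul {a b : ℝ} (hab : a ≤ b) {c : ℝ → ℝ}
    (hc : ContinuousOn c (Icc a b)) :
    ∃ E : ℝ → ℝ, (∀ t, 0 < E t) ∧
      ∀ t ∈ Icc a b, HasDerivWithinAt E (E t * c t) (Icc a b) t := by
  have hcont : Continuous (IccExtend hab (domRestrict (Icc a b) c)) :=
    hc.domRestrict.Icc_extend'
  refine ⟨fun t => Real.exp (∫ s in a..t, IccExtend hab (domRestrict (Icc a b) c) s),
    fun t => Real.exp_pos _, fun t ht => ?_⟩
  have hd := (hcont.integral_hasStrictDerivAt a t).hasDerivAt.exp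
  rw [IccExtend_of_mem hab _ ht] at hd
  exact hd.hasDerivWithinAt

/-- A function with `u' ≥ -c u` becomes monotone after multiplication by some positive
function. -/
theorem exists_pos_monotoneOn_mul {a b : ℝ} (hab : a ≤ b) {c u u' : ℝ → ℝ}
    (hc : ContinuousOn c (Icc a b))
    (hu : ∀ t ∈ Icc a b, HasDerivWithinAt u (u' t) (Icc a b) t)
    (hle : ∀ t ∈ Icc a b, 0 ≤ u' t + c t * u t) :
    ∃ E : ℝ → ℝ, (∀ t, 0 < E t) ∧ MonotoneOn (fun t => E t * u t) (Icc a b) := by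
  obtain ⟨E, hE, hE'⟩ := exists_pos_hasDerivWithinAt_mul hab hc
  have hd : ∀ t ∈ Icc a b, HasDerivWithinAt (fun t => E t * u t)
      (E t * (u' t + c t * u t)) (Icc a b) t := fun t ht =>
    ((hE' t ht).mul (hu t ht)).congr_deriv (by ring)
  refine ⟨E, hE, monotoneOn_of_hasDerivWithinAt_nonneg (convex_Icc a b)
    (fun t ht => (hd t ht).continuousWithinAt)
    (fun t ht => (hd t (interior_subset ht)).mono interior_subset)
    (fun t ht => mul_nonneg (hE t).le (hle t (interior_subset ht)))⟩

theorem nonneg_right_of_deriv_add_mul_nonneg {a b : ℝ} (hab : a ≤ b) {c u u' : ℝ → ℝ}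
    (hc : ContinuousOn c (Icc a b))
    (hu : ∀ t ∈ Icc a b, HasDerivWithinAt u (u' t) (Icc a b) t)
    (hle : ∀ t ∈ Icc a b, 0 ≤ u' t + c t * u t) (ha : 0 ≤ u a) :
    ∀ t ∈ Icc a b, 0 ≤ u t := by
  obtain ⟨E, hE, hmono⟩ := exists_pos_monotoneOn_mul hab hc hu hle
  intro t ht
  have := hmono (left_mem_Icc.2 hab) ht ht.1
  exact nonneg_of_mul_nonneg_right ((mul_nonneg (hE a).le ha).trans this) (hE t)

theorem nonpos_left_of_deriv_add_mul_nonneg {a b : ℝ} (hab : a ≤ b) {c u u' : ℝ → ℝ}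
    (hc : ContinuousOn c (Icc a b))
    (hu : ∀ t ∈ Icc a b, HasDerivWithinAt u (u' t) (Icc a b) t)
    (hle : ∀ t ∈ Icc a b, 0 ≤ u' t + c t * u t) (hb : u b ≤ 0) :
    ∀ t ∈ Icc a b, u t ≤ 0 := by
  obtain ⟨E, hE, hmono⟩ := exists_pos_monotoneOn_mul hab hc hu hle
  intro t ht
  have := hmono ht (right_mem_Icc.2 hab) ht.2
  exact nonpos_of_mul_nonpos_right (this.trans (mul_nonpos_of_nonneg_of_nonpos (hE b).le hb))
    (hE t)

/-- If `x' = 1 - x / w` and `y' = 1 - y / x`, then `(y / x)' = (1 - (y / x) (2 - x / w)) / x`. -/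
theorem hasDerivWithinAt_div_of_relaxation {s : Set ℝ} {w x y : ℝ → ℝ} {t : ℝ} (hx0 : x t ≠ 0)
    (hx : HasDerivWithinAt x (1 - x t / w t) s t) (hy : HasDerivWithinAt y (1 - y t / x t) s t) :
    HasDerivWithinAt (fun t => y t / x t) ((1 - y t / x t * (2 - x t / w t)) / x t) s t := by
  refine (hy.div hx hx0).congr_deriv ?_
  generalize x t / w t = r
  field_simp
  ring

/-- Suppose the initial values `(h_i(0))_{i≥0}` are regularly ordered and
`r_2(T) ≥ 1/(2 − 1/N)`.  Then for every `i ≥ 2`, `r_i = h_i/h_{i−1}` is non-increasing on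
`[0,T]` and `r_i(t) ≥ R_{i−1}(t) = 1/(2 − r_{i−1}(t))` on `[0,T]`. -/
theorem stmt14 (N T : ℝ) (hN : 2 ≤ N) (hT0 : 0 ≤ T)
    (h : ℕ → ℝ → ℝ)
    (hpos : ∀ i, ∀ t ∈ Set.Icc (0 : ℝ) T, 0 < h i t)
    (htop : ∀ t ∈ Set.Icc (0 : ℝ) T, h 0 t = N)
    (hderiv : ∀ i, 1 ≤ i → ∀ t ∈ Set.Icc (0 : ℝ) T,
      HasDerivWithinAt (h i) (1 - h i t / h (i - 1) t) (Set.Icc 0 T) t)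
    (hlt : ∀ t ∈ Set.Ico (0 : ℝ) T, h 1 t < 1)
    (hT1 : h 1 T = 1)
    (hreg : RegularlyOrdered N (fun i => h i 0))
    (hr2 : 1 / (2 - 1 / N) ≤ h 2 T / h 1 T) :
    ∀ i, 2 ≤ i →
      AntitoneOn (fun t => h i t / h (i - 1) t) (Set.Icc 0 T) ∧
      ∀ t ∈ Set.Icc (0 : ℝ) T,
        1 / (2 - h (i - 1) t / h (i - 2) t) ≤ h i t / h (i - 1) t := by
  obtain ⟨-, -, hdec, -, hratio⟩ := hreg
  have h0 : (0 : ℝ) ∈ Icc 0 T := left_mem_Icc.2 hT0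
  have hTm : T ∈ Icc 0 T := right_mem_Icc.2 hT0
  have hN0 : 0 < N := by linarith
  set r : ℕ → ℝ → ℝ := fun n t => h (n + 1) t / h n t with hr
  set v : ℕ → ℝ → ℝ := fun n t => 1 - r (n + 1) t * (2 - r n t) with hv
  have hrpos : ∀ n, ∀ t ∈ Icc 0 T, 0 < r n t := fun n t ht =>
    div_pos (hpos _ t ht) (hpos _ t ht)
  have hr1 : ∀ t ∈ Icc 0 T, r 0 t ≤ 1 / N := fun t ht => by
    have : h 1 t ≤ 1 := by
      rcases ht.2.lt_or_eq with hlt' | rfl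
      · exact (hlt t ⟨ht.1, hlt'⟩).le
      · exact hT1.le
    simp only [hr, htop t ht]
    gcongr
  have hNhalf : 1 / N ≤ 1 / 2 := by gcongr
  have hr0' : ∀ t ∈ Icc 0 T, HasDerivWithinAt (r 0) ((1 - r 0 t) / N) (Icc 0 T) t := by
    intro t ht
    exact ((hderiv 1 le_rfl t ht).div_const N).congr (fun s hs => by simp [hr, htop s hs])
      (by simp [hr, htop t ht])
  have hr' : ∀ n, ∀ t ∈ Icc 0 T,
      HasDerivWithinAt (r (n + 1)) (v n t / h (n + 1) t) (Icc 0 T) t := fun n t ht =>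
    hasDerivWithinAt_div_of_relaxation (hpos (n + 1) t ht).ne' (hderiv (n + 1) (by omega) t ht)
      (hderiv (n + 2) (by omega) t ht)
  have hv' : ∀ n, ∀ d : ℝ, ∀ t ∈ Icc 0 T, HasDerivWithinAt (r n) d (Icc 0 T) t →
      HasDerivWithinAt (v n) (-((2 - r n t) / h (n + 1) t) * v n t + r (n + 1) t * d)
        (Icc 0 T) t := fun n d t ht hd =>
    (((hr' n t ht).mul (hd.const_sub 2)).const_sub 1).congr_deriv (by ring)
  have hrcont : ∀ n, ContinuousOn (r n) (Icc 0 T) := by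
    rintro (_ | n) t ht
    · exact (hr0' t ht).continuousWithinAt
    · exact (hr' n t ht).continuousWithinAt
  have hccont : ∀ n, ContinuousOn (fun t => (2 - r n t) / h (n + 1) t) (Icc 0 T) := fun n =>
    (continuousOn_const.sub (hrcont n)).div
      (fun t ht => (hderiv (n + 1) (by omega) t ht).continuousWithinAt)
      (fun t ht => (hpos _ t ht).ne')
  have hanti : ∀ n, (∀ t ∈ Icc 0 T, v n t ≤ 0) → AntitoneOn (r (n + 1)) (Icc 0 T) :=
    fun n hn => antitoneOn_of_hasDerivWithinAt_nonpos (convex_Icc 0 T) (hrcont _)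
      (fun t ht => (hr' n t (interior_subset ht)).mono interior_subset)
      (fun t ht => div_nonpos_of_nonpos_of_nonneg (hn t (interior_subset ht))
        (hpos _ t (interior_subset ht)).le)
  have hvnonpos : ∀ n, ∀ t ∈ Icc 0 T, r n t ≤ 1 ∧ v n t ≤ 0 := by
    intro n
    induction n with
    | zero =>
      have hle : ∀ t ∈ Icc 0 T, r 0 t ≤ 1 := fun t ht => (hr1 t ht).trans (by linarith)
      refine fun t ht => ⟨hle t ht, nonpos_left_of_deriv_add_mul_nonneg hT0 (hccont 0)
        (fun s hs => hv' 0 _ s hs (hr0' s hs)) (fun s hs => ?_) ?_ t ht⟩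
      · have := mul_nonneg (hrpos 1 s hs).le (div_nonneg (sub_nonneg.2 (hle s hs)) hN0.le)
        simp only [zero_add] at this ⊢
        linarith
      · have hrT : r 0 T = 1 / N := by simp [hr, hT1, htop T hTm]
        have : 1 ≤ r 1 T * (2 - 1 / N) := (div_le_iff₀ (by linarith)).1 hr2
        simp only [hv, hrT, zero_add]
        linarith
    | succ n ih =>
      have hle : ∀ t ∈ Icc 0 T, r (n + 1) t ≤ 1 := fun t ht =>
        (hanti n (fun s hs => (ih s hs).2) h0 ht ht.1).trans
          ((div_le_one (hpos _ 0 h0)).2 (hdec (n + 1) (by omega)))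
      refine fun t ht => ⟨hle t ht, ?_⟩
      have := nonneg_right_of_deriv_add_mul_nonneg hT0 (hccont (n + 1))
        (fun s hs => (hv' (n + 1) _ s hs (hr' n s hs)).neg) (fun s hs => ?_) ?_ t ht
      · simpa using this
      · have := mul_nonpos_of_nonneg_of_nonpos (hrpos (n + 2) s hs).le
          (div_nonpos_of_nonpos_of_nonneg (ih s hs).2 (hpos (n + 1) s hs).le)
        simp only [Pi.neg_apply]
        linarith
      · have hinit : 1 / (2 - r (n + 1) 0) ≤ r (n + 2) 0 := hratio (n + 3) (by omega)
        rw [div_le_iff₀ (by linarith [hle 0 h0])] at hinit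
        simp only [Pi.neg_apply, hv]
        linarith
  intro i hi
  obtain ⟨n, rfl⟩ := Nat.exists_eq_add_of_le' hi
  refine ⟨hanti n fun t ht => (hvnonpos n t ht).2, fun t ht => ?_⟩
  obtain ⟨hrt, hvt⟩ := hvnonpos n t ht
  change 1 / (2 - r n t) ≤ r (n + 1) t
  rw [div_le_iff₀ (by linarith)]
  linarith [show 1 - r (n + 1) t * (2 - r n t) ≤ 0 from hvt]
end

section
/- Let (h_i)_{i≥0} on [0,T] and (h'_i)_{i≥0} on [0,T'] be two such solutions, where T and T' are the first times h_1 and h'_1 reach 1 respectively, both with regularly ordered initial values. Suppose h'_1(0) ≥ h_1(0), r'_i(0) ≥ r_i(0) for all i ≥ 2, and r_2(T) ≥ 1/(2 − 1/N). Then h'_i(T') ≥ h_i(T) and r'_i(T') ≥ r_i(T) for all i ≥ 1. -/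
/-- A solution of the fluid system `h_i' = 1 − h_i/h_{i−1}` on `[0,T]` with `h_0 ≡ N`,
strictly positive, where `T` is the first time `h_1` reaches `1`. -/
structure RSol (N T : ℝ) where
  h : ℕ → ℝ → ℝ
  pos : ∀ i, ∀ t ∈ Set.Icc (0 : ℝ) T, 0 < h i t
  top : ∀ t ∈ Set.Icc (0 : ℝ) T, h 0 t = N
  lt_one : ∀ t ∈ Set.Ico (0 : ℝ) T, h 1 t < 1
  at_T : h 1 T = 1
  deriv : ∀ i, 1 ≤ i → ∀ t ∈ Set.Icc (0 : ℝ) T,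
    HasDerivWithinAt (h i) (1 - h i t / h (i - 1) t) (Set.Icc 0 T) t

/-- Integrating factor: if `f' + c f ≥ 0` on `[a,b]` with `c` continuous, then some positive
multiplier makes `f` monotone. -/
theorem exists_pos_mul_monotoneOn {a b : ℝ} {f f' c : ℝ → ℝ}
    (hf : ∀ t ∈ Set.Icc a b, HasDerivWithinAt f (f' t) (Set.Icc a b) t)
    (hc : ContinuousOn c (Set.Icc a b))
    (hle : ∀ t ∈ Set.Icc a b, 0 ≤ f' t + c t * f t) :
    ∃ φ : ℝ → ℝ, (∀ t, 0 < φ t) ∧ MonotoneOn (fun t => f t * φ t) (Set.Icc a b) := by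
  rcases lt_or_ge b a with hba | hab
  · exact ⟨fun _ => 1, fun _ => one_pos,
      fun x hx => absurd (hx.1.trans hx.2) hba.not_ge⟩
  set C : ℝ → ℝ := Set.IccExtend hab ((Set.Icc a b).domRestrict c)
  have hC : Continuous C := (continuousOn_iff_continuous_domRestrict.1 hc).Icc_extend'
  have hd : ∀ t, HasDerivAt (fun t => Real.exp (∫ x in a..t, C x))
      (Real.exp (∫ x in a..t, C x) * C t) t := fun t =>
    (hC.integral_hasStrictDerivAt a t).hasDerivAt.exp
  have hg : ∀ t ∈ Set.Icc a b, HasDerivWithinAt (fun t => f t * Real.exp (∫ x in a..t, C x))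
      (f' t * Real.exp (∫ x in a..t, C x) + f t * (Real.exp (∫ x in a..t, C x) * C t))
      (Set.Icc a b) t := fun t ht => (hf t ht).mul (hd t).hasDerivWithinAt
  refine ⟨fun t => Real.exp (∫ x in a..t, C x), fun _ => Real.exp_pos _,
    monotoneOn_of_hasDerivWithinAt_nonneg (convex_Icc a b)
      (fun t ht => (hg t ht).continuousWithinAt)
      (fun t ht => (hg t (interior_subset ht)).mono interior_subset) fun t ht => ?_⟩
  have ht := interior_subset ht
  have hCt : C t = c t := Set.IccExtend_of_mem hab _ ht
  rw [hCt]
  have := mul_nonneg (hle t ht) (Real.exp_pos (∫ x in a..t, C x)).le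
  linarith

theorem nonneg_of_deriv_add_mul_nonneg {a b : ℝ} {f f' c : ℝ → ℝ}
    (hf : ∀ t ∈ Set.Icc a b, HasDerivWithinAt f (f' t) (Set.Icc a b) t)
    (hc : ContinuousOn c (Set.Icc a b))
    (hle : ∀ t ∈ Set.Icc a b, 0 ≤ f' t + c t * f t) (ha : 0 ≤ f a) :
    ∀ t ∈ Set.Icc a b, 0 ≤ f t := by
  obtain ⟨φ, hφ, hmono⟩ := exists_pos_mul_monotoneOn hf hc hle
  intro t ht
  have h := hmono (Set.left_mem_Icc.2 (ht.1.trans ht.2)) ht ht.1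
  exact nonneg_of_mul_nonneg_left ((mul_nonneg ha (hφ a).le).trans h) (hφ t)

theorem nonneg_of_deriv_add_mul_nonpos {a b : ℝ} {f f' c : ℝ → ℝ}
    (hf : ∀ t ∈ Set.Icc a b, HasDerivWithinAt f (f' t) (Set.Icc a b) t)
    (hc : ContinuousOn c (Set.Icc a b))
    (hle : ∀ t ∈ Set.Icc a b, f' t + c t * f t ≤ 0) (hb : 0 ≤ f b) :
    ∀ t ∈ Set.Icc a b, 0 ≤ f t := by
  obtain ⟨φ, hφ, hmono⟩ := exists_pos_mul_monotoneOn (f := fun t => -f t) (f' := fun t => -f' t)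
    (fun t ht => (hf t ht).neg) hc (fun t ht => by linarith [hle t ht])
  intro t ht
  have h : -f t * φ t ≤ -f b * φ b := hmono ht (Set.right_mem_Icc.2 (ht.1.trans ht.2)) ht.2
  have hb' := mul_nonneg hb (hφ b).le
  exact nonneg_of_mul_nonneg_left (by linarith) (hφ t)

namespace RSol

variable {N T : ℝ} (S : RSol N T)

/-- The ratio of consecutive terms, `r_{i+1} = h_{i+1} / h_i`. -/
noncomputable def ratio (i : ℕ) (t : ℝ) : ℝ := S.h (i + 1) t / S.h i t

theorem ratio_pos (i : ℕ) {t : ℝ} (ht : t ∈ Set.Icc 0 T) : 0 < S.ratio i t :=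
  div_pos (S.pos _ t ht) (S.pos _ t ht)

theorem continuousOn_h (i : ℕ) : ContinuousOn (S.h i) (Set.Icc 0 T) := by
  cases i with
  | zero => exact continuousOn_const.congr S.top
  | succ i => exact fun t ht => (S.deriv (i + 1) (by omega) t ht).continuousWithinAt

theorem continuousOn_ratio (i : ℕ) : ContinuousOn (S.ratio i) (Set.Icc 0 T) :=
  (S.continuousOn_h _).div (S.continuousOn_h i) fun t ht => (S.pos i t ht).ne'

theorem continuousOn_rate (i : ℕ) :
    ContinuousOn (fun t => (2 - S.ratio i t) / S.h (i + 1) t) (Set.Icc 0 T) :=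
  (continuousOn_const.sub (S.continuousOn_ratio i)).div (S.continuousOn_h _)
    fun t ht => (S.pos _ t ht).ne'

theorem hasDerivWithinAt_ratio_zero {t : ℝ} (ht : t ∈ Set.Icc 0 T) :
    HasDerivWithinAt (S.ratio 0) ((1 - S.ratio 0 t) / N) (Set.Icc 0 T) t := by
  have h := (S.deriv 1 le_rfl t ht).div_const N
  rw [ratio, S.top t ht]
  rw [Nat.sub_self, S.top t ht] at h
  exact h.congr_of_mem (fun x hx => by simp [ratio, S.top x hx]) ht

theorem hasDerivWithinAt_ratio_succ (i : ℕ) {t : ℝ} (ht : t ∈ Set.Icc 0 T) :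
    HasDerivWithinAt (S.ratio (i + 1))
      ((1 - S.ratio (i + 1) t * (2 - S.ratio i t)) / S.h (i + 1) t) (Set.Icc 0 T) t := by
  have h0 := (S.pos i t ht).ne'
  have h1 := (S.pos (i + 1) t ht).ne'
  refine ((S.deriv (i + 2) (by omega) t ht).fun_div (S.deriv (i + 1) (by omega) t ht)
    h1).congr_deriv ?_
  simp only [ratio, Nat.add_sub_cancel, show i + 2 - 1 = i + 1 from rfl]
  field_simp
  ring

theorem h_one_le_one {t : ℝ} (ht : t ∈ Set.Icc 0 T) : S.h 1 t ≤ 1 := by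
  rcases ht.2.lt_or_eq with h | rfl
  · exact (S.lt_one t ⟨ht.1, h⟩).le
  · exact S.at_T.le

theorem h_one_eq (hN : N ≠ 0) {t : ℝ} (ht : t ∈ Set.Icc 0 T) :
    S.h 1 t = N - (N - 1) * Real.exp ((T - t) / N) := by
  have hd : ∀ x ∈ Set.Icc 0 T, HasDerivWithinAt
      (fun x => (N - S.h 1 x) * Real.exp (x / N)) 0 (Set.Icc 0 T) x := by
    intro x hx
    have h := S.deriv 1 le_rfl x hx
    rw [Nat.sub_self, S.top x hx] at h
    refine ((h.const_sub N).mul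
      (((hasDerivAt_id x).div_const N).exp.hasDerivWithinAt)).congr_deriv ?_
    simp only [id]
    field_simp
    ring
  have hT := S.at_T
  have hnorm := (convex_Icc 0 T).norm_image_sub_le_of_norm_hasDerivWithin_le (C := 0) hd
    (fun _ _ => norm_zero.le) (Set.right_mem_Icc.2 (ht.1.trans ht.2)) ht
  rw [zero_mul, norm_le_zero_iff, sub_eq_zero] at hnorm
  have hconst : (N - S.h 1 t) * Real.exp (t / N) = (N - S.h 1 T) * Real.exp (T / N) := hnorm
  rw [hT] at hconst
  rw [sub_div, Real.exp_sub]
  have := (Real.exp_pos (t / N)).ne'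
  field_simp
  linarith

/-- Regular ordering persists along a solution that ends regularly ordered at the second level. -/
theorem one_le_ratio_mul (hN : 1 ≤ N)
    (h0 : ∀ i, 1 ≤ S.ratio (i + 1) 0 * (2 - S.ratio i 0))
    (h1 : 1 ≤ S.ratio 1 T * (2 - S.ratio 0 T)) (i : ℕ) :
    ∀ t ∈ Set.Icc 0 T, 1 ≤ S.ratio (i + 1) t * (2 - S.ratio i t) := by
  suffices h : ∀ t ∈ Set.Icc 0 T, 0 ≤ S.ratio (i + 1) t * (2 - S.ratio i t) - 1 from
    fun t ht => sub_nonneg.1 (h t ht)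
  induction i with
  | zero =>
    refine nonneg_of_deriv_add_mul_nonpos
      (fun t ht => ((S.hasDerivWithinAt_ratio_succ 0 ht).mul
        ((S.hasDerivWithinAt_ratio_zero ht).const_sub 2)).sub_const 1)
      (S.continuousOn_rate 0) (fun t ht => ?_) (sub_nonneg.2 h1)
    have hr : S.ratio 0 t ≤ 1 := by
      rw [ratio, S.top t ht, div_le_one (by linarith)]
      exact (S.h_one_le_one ht).trans hN
    have h := mul_nonneg (S.ratio_pos 1 ht).le
      (div_nonneg (sub_nonneg.2 hr) (zero_le_one.trans hN))
    simp only [zero_add] at *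
    refine le_trans (le_of_eq ?_) (neg_nonpos.2 h)
    ring
  | succ i ih =>
    refine nonneg_of_deriv_add_mul_nonneg
      (fun t ht => ((S.hasDerivWithinAt_ratio_succ (i + 1) ht).mul
        ((S.hasDerivWithinAt_ratio_succ i ht).const_sub 2)).sub_const 1)
      (S.continuousOn_rate (i + 1)) (fun t ht => ?_) (sub_nonneg.2 (h0 _))
    have h := mul_nonneg (S.ratio_pos (i + 2) ht).le
      (div_nonneg (ih t ht) (S.pos (i + 1) t ht).le)
    refine h.trans (le_of_eq ?_)
    ring

theorem antitoneOn_ratio_succ (i : ℕ)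
    (h : ∀ t ∈ Set.Icc 0 T, 1 ≤ S.ratio (i + 1) t * (2 - S.ratio i t)) :
    AntitoneOn (S.ratio (i + 1)) (Set.Icc 0 T) :=
  antitoneOn_of_hasDerivWithinAt_nonpos (convex_Icc 0 T) (S.continuousOn_ratio _)
    (fun t ht => (S.hasDerivWithinAt_ratio_succ i (interior_subset ht)).mono interior_subset)
    fun t ht => div_nonpos_of_nonpos_of_nonneg (sub_nonpos.2 (h t (interior_subset ht)))
      (S.pos _ t (interior_subset ht)).le

/-- Comparison of two solutions run backwards from their common terminal value of `h_1`. -/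
theorem ratio_le_ratio_and_h_le_h {T' : ℝ} (S' : RSol N T') (hN : N ≠ 0) (hTT : T' ≤ T)
    (hreg : ∀ i, ∀ t ∈ Set.Icc 0 T, 1 ≤ S.ratio (i + 1) t * (2 - S.ratio i t))
    (h0 : ∀ i, S.ratio (i + 1) 0 ≤ S'.ratio (i + 1) 0) (i : ℕ) :
    ∀ t ∈ Set.Icc 0 T', S.ratio i (t + (T - T')) ≤ S'.ratio i t ∧
      S.h (i + 1) (t + (T - T')) ≤ S'.h (i + 1) t := by
  have hmaps : Set.MapsTo (fun t => t + (T - T')) (Set.Icc 0 T') (Set.Icc 0 T) :=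
    fun t ht => ⟨by linarith [ht.1], by linarith [ht.2]⟩
  induction i with
  | zero =>
    intro t ht
    have h : S.h 1 (t + (T - T')) = S'.h 1 t := by
      rw [S.h_one_eq hN (hmaps ht), S'.h_one_eq hN ht]
      ring_nf
    simp [ratio, S.top _ (hmaps ht), S'.top t ht, h]
  | succ i ih =>
    intro t ht
    have hshift : ∀ x ∈ Set.Icc 0 T', HasDerivWithinAt (fun x => S.ratio (i + 1) (x + (T - T')))
        ((1 - S.ratio (i + 1) (x + (T - T')) * (2 - S.ratio i (x + (T - T')))) /
          S.h (i + 1) (x + (T - T')) * 1) (Set.Icc 0 T') x := fun x hx =>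
      HasDerivWithinAt.comp (h := fun x => x + (T - T')) x
        (S.hasDerivWithinAt_ratio_succ i (hmaps hx))
        ((hasDerivWithinAt_id x _).add_const _) hmaps
    have hle : S.ratio (i + 1) (t + (T - T')) ≤ S'.ratio (i + 1) t := by
      refine sub_nonneg.1 (nonneg_of_deriv_add_mul_nonneg
        (f := fun x => S'.ratio (i + 1) x - S.ratio (i + 1) (x + (T - T')))
        (fun x hx => (S'.hasDerivWithinAt_ratio_succ i hx).sub (hshift x hx))
        (S'.continuousOn_rate i) (fun x hx => ?_) ?_ t ht)
      · obtain ⟨hr, hh⟩ := ih x hx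
        have hE := hreg i _ (hmaps hx)
        have hρ := (S.ratio_pos (i + 1) (hmaps hx)).le
        have hp := S.pos (i + 1) _ (hmaps hx)
        have hp' := S'.pos (i + 1) x hx
        have hfrac := div_le_div_of_nonneg_left (sub_nonneg.2 hE) hp hh
        have hq := div_nonneg (mul_nonneg hρ (sub_nonneg.2 hr)) hp'.le
        refine (add_nonneg hq (sub_nonneg.2 hfrac)).trans (le_of_eq ?_)
        ring
      · have hs : T - T' ∈ Set.Icc 0 T := ⟨by linarith, by linarith [ht.1, ht.2]⟩
        have h := S.antitoneOn_ratio_succ i (hreg i) (Set.left_mem_Icc.2 (hs.1.trans hs.2)) hs hs.1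
        rw [zero_add]
        exact sub_nonneg.2 (h.trans (h0 i))
    refine ⟨hle, ?_⟩
    have hx := S.pos (i + 1) _ (hmaps ht)
    have hx' := S'.pos (i + 1) t ht
    have hm := mul_le_mul hle (ih t ht).2 hx.le (S'.ratio_pos (i + 1) ht).le
    simpa only [ratio, div_mul_cancel₀ _ hx.ne', div_mul_cancel₀ _ hx'.ne'] using hm

end RSol

/-- Let `(h_i)` on `[0,T]` and `(h'_i)` on `[0,T']` be two solutions with
regularly ordered initial values.  If `h'_1(0) ≥ h_1(0)`, `r'_i(0) ≥ r_i(0)` for all `i ≥ 2`,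
and `r_2(T) ≥ 1/(2 − 1/N)`, then `h'_i(T') ≥ h_i(T)` and `r'_i(T') ≥ r_i(T)` for all
`i ≥ 1`. -/
theorem stmt15 (N T T' : ℝ) (hN : 2 ≤ N) (hT : 0 ≤ T) (hT' : 0 ≤ T')
    (S : RSol N T) (S' : RSol N T')
    (hreg : RegularlyOrdered N (fun i => S.h i 0))
    (hreg' : RegularlyOrdered N (fun i => S'.h i 0))
    (h10 : S.h 1 0 ≤ S'.h 1 0)
    (hr0 : ∀ i, 2 ≤ i → S.h i 0 / S.h (i - 1) 0 ≤ S'.h i 0 / S'.h (i - 1) 0)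
    (hr2 : 1 / (2 - 1 / N) ≤ S.h 2 T / S.h 1 T) :
    ∀ i, 1 ≤ i → S.h i T ≤ S'.h i T' ∧
      S.h i T / S.h (i - 1) T ≤ S'.h i T' / S'.h (i - 1) T' := by
  have hN0 : N ≠ 0 := by linarith
  have h00 : (0 : ℝ) ∈ Set.Icc 0 T := Set.left_mem_Icc.2 hT
  have h00' : (0 : ℝ) ∈ Set.Icc 0 T' := Set.left_mem_Icc.2 hT'
  have hTT : T' ≤ T := by
    rw [S.h_one_eq hN0 h00, S'.h_one_eq hN0 h00', sub_le_sub_iff_left,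
      mul_le_mul_iff_right₀ (by linarith), Real.exp_le_exp,
      div_le_div_iff_of_pos_right (by linarith)] at h10
    linarith
  obtain ⟨-, -, hmono, hone, hord⟩ := hreg
  have hreg0 : ∀ i, 1 ≤ S.ratio (i + 1) 0 * (2 - S.ratio i 0) := by
    intro i
    have hr : S.ratio i 0 ≤ 1 := by
      rw [RSol.ratio, div_le_one (S.pos i 0 h00)]
      cases i with
      | zero => rw [S.top 0 h00]; exact hone.trans (by linarith)
      | succ i => exact hmono (i + 1) (by omega)
    exact (div_le_iff₀ (by linarith)).1 (hord (i + 2) (by omega))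
  have hregT : 1 ≤ S.ratio 1 T * (2 - S.ratio 0 T) := by
    have hinv : 1 / N ≤ 1 := by rw [div_le_one (by linarith)]; linarith
    have h0 : S.ratio 0 T = 1 / N := by
      rw [RSol.ratio, S.top T (Set.right_mem_Icc.2 hT), zero_add, S.at_T]
    rw [h0]
    exact (div_le_iff₀ (by linarith)).1 hr2
  intro i hi
  obtain ⟨i, rfl⟩ : ∃ j, i = j + 1 := ⟨i - 1, by omega⟩
  have h := S.ratio_le_ratio_and_h_le_h S' hN0 hTT
    (S.one_le_ratio_mul (by linarith) hreg0 hregT)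
    (fun i => hr0 (i + 2) (by omega)) i T' (Set.right_mem_Icc.2 hT')
  rw [add_sub_cancel] at h
  exact ⟨h.2, h.1⟩
end

section
/- Let N ≥ N' > 1 be reals, let h₀ ∈ [0,1], and set γ = (1 − 1/N)/(1 − 1/N'). Define f(t) = N' − (N' − h₀)·e^{−γt/N'} and g(t) = N − (N − h₀)·e^{−t/N}. If t ≥ 0 and f(s) ≤ 1 for all s ∈ [0,t], then f(t) ≥ g(t). -/
/-- Let `N ≥ N' > 1`, `h₀ ∈ [0,1]`, `γ = (1 − 1/N)/(1 − 1/N')`,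
`f(t) = N' − (N' − h₀)e^{−γt/N'}` and `g(t) = N − (N − h₀)e^{−t/N}`.  If `t ≥ 0` and
`f(s) ≤ 1` for all `s ∈ [0,t]`, then `f(t) ≥ g(t)`. -/
theorem stmt17 (N N' h₀ : ℝ) (hN' : 1 < N') (hNN : N' ≤ N)
    (hh : h₀ ∈ Set.Icc (0 : ℝ) 1) (γ : ℝ) (hγ : γ = (1 - 1 / N) / (1 - 1 / N'))
    (t : ℝ) (ht : 0 ≤ t)
    (hf : ∀ s ∈ Set.Icc (0 : ℝ) t, N' - (N' - h₀) * Real.exp (-(γ * s) / N') ≤ 1) :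
    N - (N - h₀) * Real.exp (-t / N) ≤ N' - (N' - h₀) * Real.exp (-(γ * t) / N') := by
  have hN'0 : 0 < N' := by linarith
  have hN0 : 0 < N := by linarith
  have hinv : 1 / N ≤ 1 / N' := one_div_le_one_div_of_le hN'0 hNN
  have hinv' : 1 / N' < 1 := by rw [div_lt_one hN'0]; exact hN'
  have hγmul : γ * (1 - 1 / N') = 1 - 1 / N := by
    rw [hγ]; exact div_mul_cancel₀ _ (by linarith)
  have hγ1 : 1 ≤ γ := by
    rw [hγ, le_div_iff₀ (by linarith)]; linarith
  have hrate : 1 / N ≤ γ * (1 / N') :=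
    hinv.trans (le_mul_of_one_le_left (by positivity) hγ1)
  set f : ℝ → ℝ := fun s => N' - (N' - h₀) * Real.exp (-(γ * s) / N') with hfdef
  have hfd (s : ℝ) : HasDerivAt f (γ * (1 - f s * (1 / N'))) s := by
    have h := (((((hasDerivAt_id s).const_mul γ).neg.div_const N').exp).const_mul
      (N' - h₀)).const_sub N'
    refine h.congr_deriv ?_
    simp only [hfdef, id, Pi.neg_apply]
    field_simp
    ring
  have hFd (s : ℝ) : HasDerivAt (fun s => (f s - N) * Real.exp (s / N))
      ((1 - f s) * (γ * (1 / N') - 1 / N) * Real.exp (s / N)) s := by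
    have h := ((hfd s).sub_const N).mul (((hasDerivAt_id s).div_const N).exp)
    refine h.congr_deriv ?_
    have hNinv : N * (1 / N) = 1 := mul_one_div_cancel hN0.ne'
    simp only [id]
    linear_combination Real.exp (s / N) * (hγmul - hNinv)
  have hmono : MonotoneOn (fun s => (f s - N) * Real.exp (s / N)) (Set.Icc 0 t) := by
    refine monotoneOn_of_deriv_nonneg (convex_Icc 0 t)
      (fun s _ => (hFd s).continuousAt.continuousWithinAt)
      (fun s _ => (hFd s).differentiableAt.differentiableWithinAt) fun s hs => ?_
    rw [(hFd s).deriv]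
    have hs1 : f s ≤ 1 := hf s (interior_subset hs)
    exact mul_nonneg (mul_nonneg (by linarith) (by linarith)) (Real.exp_pos _).le
  have hle := hmono (Set.left_mem_Icc.2 ht) (Set.right_mem_Icc.2 ht) ht
  have hf0 : f 0 = h₀ := by simp [hfdef]
  simp only [hf0, zero_div, Real.exp_zero, mul_one] at hle
  have hexp : Real.exp (t / N) * Real.exp (-t / N) = 1 := by
    rw [← Real.exp_add, neg_div, add_neg_cancel, Real.exp_zero]
  have hmul := mul_le_mul_of_nonneg_right hle (Real.exp_pos (-t / N)).le
  rw [mul_assoc, hexp, mul_one] at hmul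
  change _ ≤ f t
  linarith
end

section
/- Let T > 0 and let r_i : [0,T] → ℝ for i ≥ 1 be functions such that r_i(t) > 0 for all i and t, r_1(t) ≤ 1/2 for all t ∈ [0,T], and for every i ≥ 2, r_i is differentiable with r_i'(t) = 1 − r_i(t)/r_{i−1}(t) on [0,T] and r_i(0) ≤ 1/2. Then r_i(t) ≤ 1/2 for all i ≥ 1 and all t ∈ [0,T]. -/
/-- For the proportioned-forwarding ratio system `r_i' = 1 − r_i/r_{i−1}` on
`[0,T]` with all `r_i > 0`, `r_1 ≤ 1/2` throughout and `r_i(0) ≤ 1/2` for `i ≥ 2`, we have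
`r_i(t) ≤ 1/2` for all `i ≥ 1` and `t ∈ [0,T]`. -/
theorem stmt18 (T : ℝ) (hT : 0 < T) (r : ℕ → ℝ → ℝ)
    (hpos : ∀ i, 1 ≤ i → ∀ t ∈ Set.Icc (0 : ℝ) T, 0 < r i t)
    (h1 : ∀ t ∈ Set.Icc (0 : ℝ) T, r 1 t ≤ 1 / 2)
    (hderiv : ∀ i, 2 ≤ i → ∀ t ∈ Set.Icc (0 : ℝ) T,
      HasDerivWithinAt (r i) (1 - r i t / r (i - 1) t) (Set.Icc 0 T) t)
    (hinit : ∀ i, 2 ≤ i → r i 0 ≤ 1 / 2) :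
    ∀ i, 1 ≤ i → ∀ t ∈ Set.Icc (0 : ℝ) T, r i t ≤ 1 / 2 := by
  intro i hi
  induction i, hi using Nat.le_induction with
  | base => exact h1
  | succ n hn ih =>
    intro t ht
    refine le_of_forall_pos_le_add fun ε hε => ?_
    have hd := hderiv (n + 1) (by omega)
    rw [Nat.add_sub_cancel] at hd
    refine image_le_of_deriv_right_lt_deriv_boundary (f := r (n + 1)) (B := fun _ => 1 / 2 + ε)
      (B' := fun _ => 0) (fun x hx => (hd x hx).continuousWithinAt)
      (fun x hx => (hd x (Set.Ico_subset_Icc_self hx)).mono_of_mem_nhdsWithin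
        (Icc_mem_nhdsGE_of_mem hx))
      (by linarith [hinit (n + 1) (by omega)]) (fun x => hasDerivAt_const x _) ?_ ht
    intro x hx hxe
    have hx' := Set.Ico_subset_Icc_self hx
    have hp := hpos n hn x hx'
    have : 1 < r (n + 1) x / r n x := by
      rw [one_lt_div hp]
      linarith [ih x hx']
    linarith
end
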